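/- arXiv:2402.02556 — 11 statements merged into one kernel-verified Lean document; each statement's English description precedes it below -/
import Mathlib

section
/- The 𝒵-complementation ψ_𝒵 is a weak complementation: (a) ψ_𝒵(H) ⊆ Hᶜ for every subset H of Ω, and (b) whenever H ⊆ K one has Kᶜ \ ψ_𝒵(K) ⊆ Hᶜ \ ψ_𝒵(H). -/
open Set

/-- The `𝒵`-complementation: `ψ_𝒵(H) = ⋃_{n : H ∩ Z n ≠ ∅} (Hᶜ ∩ Z n)`. -/
def psiZ {Ω : Type*} {M : ℕ} (Z : Fin (M + 1) → Set Ω) (H : Set Ω) : Set Ω :=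
  ⋃ n ∈ {n : Fin (M + 1) | (H ∩ Z n).Nonempty}, Hᶜ ∩ Z n

/-- The set of uncertain opportunities of `H`: `H_{ψ_𝒵} = Hᶜ \ ψ_𝒵(H)`. -/
def uncertZ {Ω : Type*} {M : ℕ} (Z : Fin (M + 1) → Set Ω) (H : Set Ω) : Set Ω :=
  Hᶜ \ psiZ Z H

theorem psiZ_is_weak_complementation {Ω : Type*} [Nonempty Ω] {M : ℕ}
    (Z : Fin (M + 1) → Set Ω)
    (hne : ∀ n, (Z n).Nonempty)
    (hdisj : Pairwise (Function.onFun Disjoint Z))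
    (hcov : (⋃ n, Z n) = (univ : Set Ω)) :
    (∀ H : Set Ω, psiZ Z H ⊆ Hᶜ) ∧
    (∀ H K : Set Ω, H ⊆ K → Kᶜ \ psiZ Z K ⊆ Hᶜ \ psiZ Z H) := by
  constructor
  · intro H x hx
    simp only [psiZ, mem_iUnion] at hx
    obtain ⟨n, _, h, _⟩ := hx
    exact h
  · rintro H K hHK x ⟨hxK, hx⟩
    refine ⟨fun h => hxK (hHK h), fun h => hx ?_⟩
    simp only [psiZ, mem_iUnion] at h ⊢
    obtain ⟨n, ⟨y, hyH, hyZ⟩, _, hxZ⟩ := h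
    exact ⟨n, ⟨y, hHK hyH, hyZ⟩, hxK, hxZ⟩
end

section
/- The 𝒵-complementation ψ_𝒵 is regular: for every subset H of Ω one has ψ_𝒵(ψ_𝒵(H)) ⊆ H. -/
open Set

theorem psiZ_regular {Ω : Type*} [Nonempty Ω] {M : ℕ}
    (Z : Fin (M + 1) → Set Ω)
    (hne : ∀ n, (Z n).Nonempty)
    (hdisj : Pairwise (Function.onFun Disjoint Z))
    (hcov : (⋃ n, Z n) = (univ : Set Ω)) :
    ∀ H : Set Ω, psiZ Z (psiZ Z H) ⊆ H := by
  intro H x hx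
  simp only [psiZ, mem_iUnion, mem_setOf_eq, exists_prop] at hx
  obtain ⟨n, ⟨y, hy, hyn⟩, hxn, hxZ⟩ := hx
  simp only [mem_iUnion] at hy
  obtain ⟨m, hm, hyH, hym⟩ := hy
  have hmn : m = n := by
    by_contra h
    exact Set.disjoint_left.mp (hdisj h) hym hyn
  subst hmn
  by_contra hxH
  apply hxn
  simp only [mem_iUnion]
  exact ⟨m, hm, hxH, hxZ⟩
end

section
/- For every pair of subsets H, K of Ω: ψ_𝒵(H) ∪ ψ_𝒵(K) = J ∪ ⋃_{n : H ∩ Z_n ≠ ∅ and K ∩ Z_n ≠ ∅} ((Hᶜ ∪ Kᶜ) ∩ Z_n), where J = (⋃_{n : H ∩ Z_n ≠ ∅ and K ∩ Z_n = ∅} Hᶜ ∩ Z_n) ∪ (⋃_{n : K ∩ Z_n ≠ ∅ and H ∩ Z_n = ∅} Kᶜ ∩ Z_n). -/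
open Set

theorem psiZ_union_psiZ {Ω : Type*} [Nonempty Ω] {M : ℕ}
    (Z : Fin (M + 1) → Set Ω)
    (hne : ∀ n, (Z n).Nonempty)
    (hdisj : Pairwise (Function.onFun Disjoint Z))
    (hcov : (⋃ n, Z n) = (univ : Set Ω)) :
    ∀ H K : Set Ω,
      psiZ Z H ∪ psiZ Z K =
        ((⋃ n ∈ {n : Fin (M + 1) | (H ∩ Z n).Nonempty ∧ K ∩ Z n = ∅}, Hᶜ ∩ Z n) ∪
          ⋃ n ∈ {n : Fin (M + 1) | (K ∩ Z n).Nonempty ∧ H ∩ Z n = ∅}, Kᶜ ∩ Z n) ∪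
        ⋃ n ∈ {n : Fin (M + 1) | (H ∩ Z n).Nonempty ∧ (K ∩ Z n).Nonempty},
          (Hᶜ ∪ Kᶜ) ∩ Z n := by
  intro H K
  ext x
  simp only [psiZ, mem_union, mem_iUnion, mem_setOf_eq, mem_inter_iff, mem_compl_iff,
    exists_prop, ← not_nonempty_iff_eq_empty]
  constructor
  · rintro (⟨n, h, hx⟩ | ⟨n, h, hx⟩)
    · by_cases hk : (K ∩ Z n).Nonempty
      · exact Or.inr ⟨n, ⟨h, hk⟩, Or.inl hx.1, hx.2⟩
      · exact Or.inl (Or.inl ⟨n, ⟨h, hk⟩, hx⟩)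
    · by_cases hk : (H ∩ Z n).Nonempty
      · exact Or.inr ⟨n, ⟨hk, h⟩, Or.inr hx.1, hx.2⟩
      · exact Or.inl (Or.inr ⟨n, ⟨h, hk⟩, hx⟩)
  · rintro ((⟨n, h, hx⟩ | ⟨n, h, hx⟩) | ⟨n, h, hx | hx, hz⟩)
    · exact Or.inl ⟨n, h.1, hx⟩
    · exact Or.inr ⟨n, h.1, hx⟩
    · exact Or.inl ⟨n, h.1, hx, hz⟩
    · exact Or.inr ⟨n, h.2, hx, hz⟩
end

section
/- For every pair of subsets H, K of Ω, the following two inclusions hold: ψ_𝒵(H) ∩ ψ_𝒵(K) ⊆ ψ_𝒵(H ∪ K) and ψ_𝒵(H ∩ K) ⊆ ψ_𝒵(H) ∪ ψ_𝒵(K). -/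
open Set

theorem psiZ_de_morgan_inclusions {Ω : Type*} [Nonempty Ω] {M : ℕ}
    (Z : Fin (M + 1) → Set Ω)
    (hne : ∀ n, (Z n).Nonempty)
    (hdisj : Pairwise (Function.onFun Disjoint Z))
    (hcov : (⋃ n, Z n) = (univ : Set Ω)) :
    ∀ H K : Set Ω,
      psiZ Z H ∩ psiZ Z K ⊆ psiZ Z (H ∪ K) ∧
      psiZ Z (H ∩ K) ⊆ psiZ Z H ∪ psiZ Z K := by
  intro H K
  have mem : ∀ (A : Set Ω) (x : Ω),
      x ∈ psiZ Z A ↔ ∃ n, (A ∩ Z n).Nonempty ∧ x ∉ A ∧ x ∈ Z n := by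
    intro A x
    simp only [psiZ, mem_iUnion, mem_setOf_eq, mem_inter_iff, mem_compl_iff, exists_prop]
  constructor
  · rintro x ⟨h1, h2⟩
    obtain ⟨n, ⟨y, hy, hyn⟩, hx, hxn⟩ := (mem H x).1 h1
    obtain ⟨_, _, hx', _⟩ := (mem K x).1 h2
    exact (mem _ x).2 ⟨n, ⟨y, Or.inl hy, hyn⟩, fun h => h.elim hx hx', hxn⟩
  · intro x h
    obtain ⟨n, ⟨y, hy, hyn⟩, hx, hxn⟩ := (mem _ x).1 h
    by_cases hH : x ∈ H
    · exact Or.inr ((mem K x).2 ⟨n, ⟨y, hy.2, hyn⟩, fun hK => hx ⟨hH, hK⟩, hxn⟩)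
    · exact Or.inl ((mem H x).2 ⟨n, ⟨y, hy.1, hyn⟩, hH, hxn⟩)
end

section
/- Suppose M ≥ 1 and B is a nonempty subset strictly contained in Z_1. Set H = Z_0 and K = Z_0 ∪ B. Then ψ_𝒵(H) = ∅ and ψ_𝒵(K) = Z_1 \ B; in particular ψ_𝒵(K) is not contained in ψ_𝒵(H), and H ∪ H_{ψ_𝒵} is not contained in K ∪ K_{ψ_𝒵} (indeed H ∪ H_{ψ_𝒵} = Ω while K ∪ K_{ψ_𝒵} = Ω \ (Z_1 \ B)). -/
open Set

theorem psiZ_counterexample_remark {Ω : Type*} [Nonempty Ω] {M : ℕ} (hM : 1 ≤ M)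
    (Z : Fin (M + 1) → Set Ω)
    (hne : ∀ n, (Z n).Nonempty)
    (hdisj : Pairwise (Function.onFun Disjoint Z))
    (hcov : (⋃ n, Z n) = (univ : Set Ω))
    (i0 i1 : Fin (M + 1)) (h0 : (i0 : ℕ) = 0) (h1 : (i1 : ℕ) = 1)
    (B : Set Ω) (hB : B.Nonempty) (hBsub : B ⊂ Z i1) :
    psiZ Z (Z i0) = ∅ ∧
    psiZ Z (Z i0 ∪ B) = Z i1 \ B ∧
    ¬ psiZ Z (Z i0 ∪ B) ⊆ psiZ Z (Z i0) ∧
    Z i0 ∪ uncertZ Z (Z i0) = (univ : Set Ω) ∧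
    (Z i0 ∪ B) ∪ uncertZ Z (Z i0 ∪ B) = (univ : Set Ω) \ (Z i1 \ B) ∧
    ¬ Z i0 ∪ uncertZ Z (Z i0) ⊆ (Z i0 ∪ B) ∪ uncertZ Z (Z i0 ∪ B) := by
  have hu : ∀ x i j, x ∈ Z i → x ∈ Z j → i = j := by
    intro x i j hi hj
    by_contra h
    exact Set.disjoint_left.1 (hdisj h) hi hj
  have h01 : i0 ≠ i1 := by
    intro h
    rw [h] at h0
    omega
  obtain ⟨hs, hns⟩ := hBsub
  obtain ⟨b, hb⟩ := hB
  obtain ⟨c, hc, hcB⟩ := Set.not_subset.1 hns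
  have e1 : psiZ Z (Z i0) = ∅ := by
    apply Set.eq_empty_of_forall_notMem
    intro x hx
    simp only [psiZ, mem_iUnion, mem_setOf_eq] at hx
    obtain ⟨n, ⟨y, hy0, hyn⟩, hx0, hxn⟩ := hx
    exact hx0 (hu y i0 n hy0 hyn ▸ hxn)
  have e2 : psiZ Z (Z i0 ∪ B) = Z i1 \ B := by
    ext x
    simp only [psiZ, mem_iUnion, mem_setOf_eq]
    constructor
    · rintro ⟨n, ⟨y, hy0, hyn⟩, hx0, hxn⟩
      rcases hy0 with hy | hy
      · exact absurd (Or.inl (hu y i0 n hy hyn ▸ hxn)) hx0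
      · exact ⟨hu y i1 n (hs hy) hyn ▸ hxn, fun h => hx0 (Or.inr h)⟩
    · rintro ⟨hx, hxB⟩
      refine ⟨i1, ⟨b, Or.inr hb, hs hb⟩, ?_, hx⟩
      rintro (h | h)
      · exact h01 (hu x _ _ h hx)
      · exact hxB h
  have e3 : Z i0 ∪ uncertZ Z (Z i0) = (univ : Set Ω) := by
    rw [uncertZ, e1, diff_empty, union_compl_self]
  have e4 : (Z i0 ∪ B) ∪ uncertZ Z (Z i0 ∪ B) = (univ : Set Ω) \ (Z i1 \ B) := by
    rw [uncertZ, e2]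
    ext x
    have := hu x i0 i1
    simp only [mem_union, mem_diff, mem_compl_iff, mem_univ, true_and]
    tauto
  refine ⟨e1, e2, ?_, e3, e4, ?_⟩
  · rw [e1, e2]
    exact fun h => h ⟨hc, hcB⟩
  · rw [e3, e4]
    exact fun h => (h (mem_univ c)).2 ⟨hc, hcB⟩
end

section
/- For every subset H of Ω: ψ_𝒵(H ∪ ψ_𝒵(H)) = ∅ (so that, in the modified lattice operations, H ∪_{ψ_𝒵} ψ_𝒵(H) = Ω), H ∩ ψ_𝒵(H) = ∅, and ψ_𝒵(ψ_𝒵(H)) ∩ Hᶜ = ∅. -/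
open Set

theorem mem_psiZ_iff_aux {Ω : Type*} {M : ℕ} (Z : Fin (M + 1) → Set Ω) (H : Set Ω) (x : Ω) :
    x ∈ psiZ Z H ↔ ∃ n, (∃ y, y ∈ H ∧ y ∈ Z n) ∧ x ∉ H ∧ x ∈ Z n := by
  simp [psiZ, Set.Nonempty]
  grind

theorem psiZ_complemented_lattice_identities {Ω : Type*} [Nonempty Ω] {M : ℕ}
    (Z : Fin (M + 1) → Set Ω)
    (hne : ∀ n, (Z n).Nonempty)
    (hdisj : Pairwise (Function.onFun Disjoint Z))
    (hcov : (⋃ n, Z n) = (univ : Set Ω)) :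
    ∀ H : Set Ω,
      psiZ Z (H ∪ psiZ Z H) = ∅ ∧
      (psiZ Z (H ∪ psiZ Z H))ᶜ = (univ : Set Ω) ∧
      H ∩ psiZ Z H = ∅ ∧
      psiZ Z (psiZ Z H) ∩ Hᶜ = ∅ := by
  intro H
  have huniq : ∀ {x m n}, x ∈ Z m → x ∈ Z n → m = n := by
    intro x m n hm hn
    by_contra h
    exact Set.disjoint_left.mp (hdisj h) hm hn
  have h1 : psiZ Z (H ∪ psiZ Z H) = ∅ := by
    rw [Set.eq_empty_iff_forall_notMem]
    intro x hx
    obtain ⟨n, ⟨y, hy, hyn⟩, hxn, hxZ⟩ := (mem_psiZ_iff_aux _ _ _).1 hx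
    have hxH : x ∉ H := fun h => hxn (Or.inl h)
    apply hxn
    right
    rw [mem_psiZ_iff_aux]
    rcases hy with hy | hy
    · exact ⟨n, ⟨y, hy, hyn⟩, hxH, hxZ⟩
    · obtain ⟨m, hm, _, hym⟩ := (mem_psiZ_iff_aux _ _ _).1 hy
      obtain rfl := huniq hym hyn
      exact ⟨m, hm, hxH, hxZ⟩
  refine ⟨h1, by rw [h1, Set.compl_empty], ?_, ?_⟩
  · rw [Set.eq_empty_iff_forall_notMem]
    rintro x ⟨hx, hx'⟩
    obtain ⟨n, _, hxn, _⟩ := (mem_psiZ_iff_aux _ _ _).1 hx'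
    exact hxn hx
  · rw [Set.eq_empty_iff_forall_notMem]
    rintro x ⟨hx, hxH⟩
    obtain ⟨n, ⟨y, hy, hyn⟩, hxn, hxZ⟩ := (mem_psiZ_iff_aux _ _ _).1 hx
    obtain ⟨m, hm, _, hym⟩ := (mem_psiZ_iff_aux _ _ _).1 hy
    obtain rfl := huniq hym hyn
    exact hxn ((mem_psiZ_iff_aux _ _ _).2 ⟨m, hm, hxH, hxZ⟩)
end

section
/- Let P be a probability measure on a measurable space (Ω, 𝒜) such that each cell Z_n is measurable, and let (H_k)_{k ∈ ℕ} be an increasing sequence of measurable subsets of Ω with ⋃_k H_k = H. Then lim_{k → ∞} P((H_k)_{ψ_𝒵}) = P(H_{ψ_𝒵}). -/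
open Set MeasureTheory

theorem mem_uncertZ_aux {Ω : Type*} {M : ℕ} (Z : Fin (M + 1) → Set Ω)
    (hcov : (⋃ n, Z n) = (univ : Set Ω)) (H : Set Ω) (x : Ω) :
    x ∈ uncertZ Z H ↔ ∀ n, x ∈ Z n → ∀ y ∈ H, y ∉ Z n := by
  simp only [uncertZ, psiZ, mem_diff, mem_compl_iff, mem_iUnion, mem_setOf_eq, mem_inter_iff,
    not_exists]
  constructor
  · rintro ⟨hx, h⟩ n hn y hy hyn
    exact h n ⟨y, hy, hyn⟩ ⟨hx, hn⟩
  · intro h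
    have hc : x ∈ ⋃ n, Z n := hcov ▸ mem_univ x
    obtain ⟨m, hm⟩ := mem_iUnion.1 hc
    exact ⟨fun hx => h m hm x hx hm, fun n ⟨y, hy, hyn⟩ ⟨_, hn⟩ => h n hn y hy hyn⟩

theorem tendsto_measure_uncertZ_of_increasing {Ω : Type*} [Nonempty Ω]
    [MeasurableSpace Ω] {M : ℕ}
    (Z : Fin (M + 1) → Set Ω)
    (hne : ∀ n, (Z n).Nonempty)
    (hdisj : Pairwise (Function.onFun Disjoint Z))
    (hcov : (⋃ n, Z n) = (univ : Set Ω))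
    (hZm : ∀ n, MeasurableSet (Z n))
    (P : Measure Ω) [IsProbabilityMeasure P]
    (Hseq : ℕ → Set Ω) (hmono : Monotone Hseq)
    (hmeas : ∀ k, MeasurableSet (Hseq k))
    (H : Set Ω) (hH : (⋃ k, Hseq k) = H) :
    Filter.Tendsto (fun k => P (uncertZ Z (Hseq k))) Filter.atTop
      (nhds (P (uncertZ Z H))) := by
  have hEq : uncertZ Z H = ⋂ k, uncertZ Z (Hseq k) := by
    ext x
    simp only [mem_iInter, mem_uncertZ_aux Z hcov, ← hH, mem_iUnion]
    exact ⟨fun h k n hn y hy => h n hn y ⟨k, hy⟩, fun h n hn y ⟨k, hy⟩ => h k n hn y hy⟩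
  rw [hEq]
  refine tendsto_measure_iInter_atTop (fun k => ?_) ?_ ⟨0, measure_ne_top _ _⟩
  · refine MeasurableSet.nullMeasurableSet ((hmeas k).compl.diff ?_)
    exact MeasurableSet.iUnion fun n => MeasurableSet.iUnion fun _ =>
      (hmeas k).compl.inter (hZm n)
  · intro i j hij x hx
    rw [mem_uncertZ_aux Z hcov] at hx ⊢
    exact fun n hn y hy => hx n hn y (hmono hij hy)
end

section
/- Let ψ be any weak complementation on the subsets of Ω, let P be a probability measure defined on all subsets of Ω, let ω ∈ Ω satisfy P({ω}) > 0, and let r ∈ (0,1). Then, for the event H = Ω \ {ω}, the width P(H_ψ) of the interval probability P_ψ(H) is not equal to r·P(Hᶜ); consequently no weak complementation ψ satisfies P(H_ψ) = r·P(Hᶜ) for every event H. -/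
open Set MeasureTheory

theorem no_weak_complementation_with_proportional_width {Ω : Type*} [Nonempty Ω]
    [MeasurableSpace Ω]
    (ψ : Set Ω → Set Ω)
    (hψa : ∀ H : Set Ω, ψ H ⊆ Hᶜ)
    (hψb : ∀ H K : Set Ω, H ⊆ K → Kᶜ \ ψ K ⊆ Hᶜ \ ψ H)
    (P : Measure Ω) [IsProbabilityMeasure P]
    (ω : Ω) (hω : 0 < P {ω})
    (r : ℝ) (hr : r ∈ Set.Ioo (0 : ℝ) 1) :
    P ((({ω}ᶜ : Set Ω))ᶜ \ ψ ({ω}ᶜ)) ≠ ENNReal.ofReal r * P ((({ω}ᶜ : Set Ω))ᶜ) ∧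
    ¬ ∀ H : Set Ω, P (Hᶜ \ ψ H) = ENNReal.ofReal r * P Hᶜ := by
  have key : P ((({ω}ᶜ : Set Ω))ᶜ \ ψ ({ω}ᶜ)) ≠ ENNReal.ofReal r * P ((({ω}ᶜ : Set Ω))ᶜ) := by
    rw [compl_compl]
    have hr0 : ENNReal.ofReal r ≠ 0 := by simpa using hr.1
    have hr1 : ENNReal.ofReal r < 1 := by simpa using hr.2
    intro h
    rcases Set.subset_singleton_iff_eq.mp
      (Set.diff_subset : ({ω} : Set Ω) \ ψ ({ω}ᶜ) ⊆ {ω}) with h0 | h1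
    · rw [h0, measure_empty] at h
      exact mul_ne_zero hr0 hω.ne' h.symm
    · rw [h1] at h
      have h2 := ENNReal.mul_lt_mul_left hω.ne' (measure_ne_top P {ω}) hr1
      rw [one_mul, ← h] at h2
      exact lt_irrefl _ h2
  exact ⟨key, fun h => key (h _)⟩
end

section
/- Let P be a probability measure on (Ω, 𝒜) with each Z_n measurable. Let H be a nonempty measurable set with H ⊆ Z_n for some n and P(H) + 1 − P(Z_n) > 0, and let A be a nonempty measurable set with A ⊆ Z_m for some m ≠ n. Then P((ψ_𝒵(H))ᶜ) = P(H) + 1 − P(Z_n), the left endpoint of the conditional interval probability satisfies P(A ∩ (ψ_𝒵(H))ᶜ)/P((ψ_𝒵(H))ᶜ) = P(A)/(P(H) + 1 − P(Z_n)), and the right endpoint satisfies P((ψ_𝒵(A))ᶜ ∩ (ψ_𝒵(H))ᶜ)/P((ψ_𝒵(H))ᶜ) = (P(H) + 1 − P(Z_n) − P(Z_m ∩ Aᶜ))/(P(H) + 1 − P(Z_n)). -/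
open Set MeasureTheory

theorem psiZ_eq_of_subset {Ω : Type*} {M : ℕ} (Z : Fin (M + 1) → Set Ω)
    (hdisj : Pairwise (Function.onFun Disjoint Z)) (n : Fin (M + 1)) (H : Set Ω)
    (hne : H.Nonempty) (hsub : H ⊆ Z n) : psiZ Z H = Z n \ H := by
  ext x
  simp only [psiZ, mem_setOf_eq, mem_iUnion, mem_inter_iff, mem_compl_iff, mem_diff, exists_prop]
  constructor
  · rintro ⟨k, ⟨y, hyH, hyk⟩, hx, hxk⟩
    have : k = n := by
      by_contra h
      exact Set.disjoint_left.mp (hdisj h) hyk (hsub hyH)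
    subst this
    exact ⟨hxk, hx⟩
  · rintro ⟨h1, h2⟩
    obtain ⟨y, hy⟩ := hne
    exact ⟨n, ⟨y, hy, hsub hy⟩, h2, h1⟩

theorem conditional_interval_prob_distinct_cells {Ω : Type*} [Nonempty Ω]
    [MeasurableSpace Ω] {M : ℕ}
    (Z : Fin (M + 1) → Set Ω)
    (hne : ∀ n, (Z n).Nonempty)
    (hdisj : Pairwise (Function.onFun Disjoint Z))
    (hcov : (⋃ n, Z n) = (univ : Set Ω))
    (hZm : ∀ n, MeasurableSet (Z n))
    (P : Measure Ω) [IsProbabilityMeasure P]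
    (n m : Fin (M + 1)) (hnm : m ≠ n)
    (H A : Set Ω) (hHmeas : MeasurableSet H) (hAmeas : MeasurableSet A)
    (hHne : H.Nonempty) (hAne : A.Nonempty)
    (hHsub : H ⊆ Z n) (hAsub : A ⊆ Z m)
    (hpos : 0 < P H + (1 - P (Z n))) :
    P ((psiZ Z H)ᶜ) = P H + (1 - P (Z n)) ∧
    P (A ∩ (psiZ Z H)ᶜ) / P ((psiZ Z H)ᶜ) = P A / (P H + (1 - P (Z n))) ∧
    P ((psiZ Z A)ᶜ ∩ (psiZ Z H)ᶜ) / P ((psiZ Z H)ᶜ) =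
      (P H + (1 - P (Z n)) - P (Z m ∩ Aᶜ)) / (P H + (1 - P (Z n))) := by
  have hd : Disjoint (Z m) (Z n) := hdisj hnm
  rw [psiZ_eq_of_subset Z hdisj n H hHne hHsub, psiZ_eq_of_subset Z hdisj m A hAne hAsub]
  have h1 : P ((Z n \ H)ᶜ) = P H + (1 - P (Z n)) := by
    have e : (Z n \ H)ᶜ = H ∪ (Z n)ᶜ := by
      ext x; simp only [mem_compl_iff, mem_diff, mem_union]; tauto
    rw [e, measure_union (disjoint_compl_right.mono_left hHsub) (hZm n).compl,
      prob_compl_eq_one_sub (hZm n)]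
  refine ⟨h1, ?_, ?_⟩
  · have e : A ∩ (Z n \ H)ᶜ = A := by
      refine inter_eq_left.mpr fun x hx hx' => ?_
      exact Set.disjoint_left.mp hd (hAsub hx) hx'.1
    rw [h1, e]
  · have e : (Z m \ A)ᶜ ∩ (Z n \ H)ᶜ = (Z n \ H)ᶜ \ (Z m ∩ Aᶜ) := by
      ext x; simp only [mem_compl_iff, mem_diff, mem_inter_iff]; tauto
    have hs : Z m ∩ Aᶜ ⊆ (Z n \ H)ᶜ := fun x hx hx' =>
      Set.disjoint_left.mp hd hx.1 hx'.1
    rw [e, measure_diff hs ((hZm m).inter hAmeas.compl).nullMeasurableSet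
      (measure_ne_top P _), h1]
end

section
/- Let P be a probability measure on (Ω, 𝒜) with each Z_n measurable. Let H and A be nonempty measurable sets with H ⊆ Z_n, A ⊆ Z_n for the same index n, and P(H) + 1 − P(Z_n) > 0. Then A_{ψ_𝒵} = H_{ψ_𝒵} = Ω \ Z_n, the left endpoint of the conditional interval probability satisfies P(A ∩ (ψ_𝒵(H))ᶜ)/P((ψ_𝒵(H))ᶜ) = P(A ∩ H)/(P(H) + 1 − P(Z_n)), and the right endpoint satisfies P((ψ_𝒵(A))ᶜ ∩ (ψ_𝒵(H))ᶜ)/P((ψ_𝒵(H))ᶜ) = (P(A ∩ H) + 1 − P(Z_n))/(P(H) + 1 − P(Z_n)). -/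
open Set MeasureTheory

theorem psiZ_of_subset_cell {Ω : Type*} {M : ℕ} (Z : Fin (M + 1) → Set Ω)
    (hdisj : Pairwise (Function.onFun Disjoint Z)) (n : Fin (M + 1)) (H : Set Ω)
    (hHne : H.Nonempty) (hHsub : H ⊆ Z n) : psiZ Z H = Z n \ H := by
  ext x
  simp only [psiZ, mem_iUnion, mem_setOf_eq, mem_inter_iff, mem_compl_iff, mem_diff]
  constructor
  · rintro ⟨m, ⟨y, hyH, hym⟩, hx, hxm⟩
    have hmn : m = n := by
      by_contra h
      exact Set.disjoint_left.mp (hdisj h) hym (hHsub hyH)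
    subst hmn
    exact ⟨hxm, hx⟩
  · rintro ⟨hxn, hx⟩
    obtain ⟨y, hy⟩ := hHne
    exact ⟨n, ⟨y, hy, hHsub hy⟩, hx, hxn⟩

theorem conditional_interval_prob_same_cell {Ω : Type*} [Nonempty Ω]
    [MeasurableSpace Ω] {M : ℕ}
    (Z : Fin (M + 1) → Set Ω)
    (hne : ∀ n, (Z n).Nonempty)
    (hdisj : Pairwise (Function.onFun Disjoint Z))
    (hcov : (⋃ n, Z n) = (univ : Set Ω))
    (hZm : ∀ n, MeasurableSet (Z n))
    (P : Measure Ω) [IsProbabilityMeasure P]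
    (n : Fin (M + 1))
    (H A : Set Ω) (hHmeas : MeasurableSet H) (hAmeas : MeasurableSet A)
    (hHne : H.Nonempty) (hAne : A.Nonempty)
    (hHsub : H ⊆ Z n) (hAsub : A ⊆ Z n)
    (hpos : 0 < P H + (1 - P (Z n))) :
    uncertZ Z A = uncertZ Z H ∧
    uncertZ Z H = (univ : Set Ω) \ Z n ∧
    P (A ∩ (psiZ Z H)ᶜ) / P ((psiZ Z H)ᶜ) = P (A ∩ H) / (P H + (1 - P (Z n))) ∧
    P ((psiZ Z A)ᶜ ∩ (psiZ Z H)ᶜ) / P ((psiZ Z H)ᶜ) =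
      (P (A ∩ H) + (1 - P (Z n))) / (P H + (1 - P (Z n))) := by
  have eH := psiZ_of_subset_cell Z hdisj n H hHne hHsub
  have eA := psiZ_of_subset_cell Z hdisj n A hAne hAsub
  have uH : uncertZ Z H = (univ : Set Ω) \ Z n := by
    rw [uncertZ, eH]; ext x
    have := @hHsub x
    simp only [mem_diff, mem_compl_iff, mem_univ]; tauto
  have uA : uncertZ Z A = (univ : Set Ω) \ Z n := by
    rw [uncertZ, eA]; ext x
    have := @hAsub x
    simp only [mem_diff, mem_compl_iff, mem_univ]; tauto
  have key : ∀ B : Set Ω, B ⊆ Z n → P (B ∪ (Z n)ᶜ) = P B + (1 - P (Z n)) := by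
    intro B hB
    rw [measure_union (disjoint_compl_right_iff_subset.mpr hB) (hZm n).compl,
      prob_compl_eq_one_sub (hZm n)]
  have e1 : (psiZ Z H)ᶜ = H ∪ (Z n)ᶜ := by
    rw [eH]; ext x
    simp only [mem_diff, mem_compl_iff, mem_union]; tauto
  have e2 : A ∩ (psiZ Z H)ᶜ = A ∩ H := by
    rw [eH]; ext x
    have := @hAsub x
    simp only [mem_diff, mem_compl_iff, mem_inter_iff]; tauto
  have e3 : (psiZ Z A)ᶜ ∩ (psiZ Z H)ᶜ = (A ∩ H) ∪ (Z n)ᶜ := by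
    rw [eH, eA]; ext x
    simp only [mem_diff, mem_compl_iff, mem_inter_iff, mem_union]; tauto
  refine ⟨uA.trans uH.symm, uH, ?_, ?_⟩
  · rw [e2, e1, key H hHsub]
  · rw [e3, e1, key H hHsub, key _ (inter_subset_left.trans hAsub)]
end

section
/- Let P be a probability measure on (Ω, 𝒜) with each Z_n measurable, and let 0 ≤ m ≤ M. If H is a measurable set with H ⊆ ⋃_{k=0}^{m} Z_k and H ∩ Z_k ≠ ∅ for every k ∈ {0, …, m}, then the width of the interval probability of H satisfies P(H_{ψ_𝒵}) = Σ_{k=m+1}^{M} P(Z_k). -/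
open Set MeasureTheory

theorem measure_uncertZ_of_meeting_initial_cells {Ω : Type*} [Nonempty Ω]
    [MeasurableSpace Ω] {M : ℕ}
    (Z : Fin (M + 1) → Set Ω)
    (hne : ∀ n, (Z n).Nonempty)
    (hdisj : Pairwise (Function.onFun Disjoint Z))
    (hcov : (⋃ n, Z n) = (univ : Set Ω))
    (hZm : ∀ n, MeasurableSet (Z n))
    (P : Measure Ω) [IsProbabilityMeasure P]
    (m : ℕ) (hm : m ≤ M)
    (H : Set Ω) (hHmeas : MeasurableSet H)
    (hHsub : H ⊆ ⋃ k ∈ {k : Fin (M + 1) | (k : ℕ) ≤ m}, Z k)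
    (hHmeets : ∀ k : Fin (M + 1), (k : ℕ) ≤ m → (H ∩ Z k).Nonempty) :
    P (uncertZ Z H) =
      ∑ k ∈ Finset.univ.filter (fun k : Fin (M + 1) => m < (k : ℕ)), P (Z k) := by
  have key : ∀ x (i j : Fin (M + 1)), x ∈ Z i → x ∈ Z j → i = j := by
    intro x i j hi hj
    by_contra h
    exact Set.disjoint_left.mp (hdisj h) hi hj
  have hset : uncertZ Z H =
      ⋃ k ∈ Finset.univ.filter (fun k : Fin (M + 1) => m < (k : ℕ)), Z k := by
    ext x
    simp only [uncertZ, psiZ, mem_diff, mem_compl_iff, mem_iUnion, mem_setOf_eq, mem_inter_iff,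
      Finset.mem_filter, Finset.mem_univ, true_and, exists_prop, not_exists, not_and]
    constructor
    · rintro ⟨hx, h⟩
      have hxu : x ∈ ⋃ n, Z n := by rw [hcov]; exact mem_univ x
      obtain ⟨n, hn⟩ := mem_iUnion.mp hxu
      refine ⟨n, ?_, hn⟩
      by_contra hlt
      exact h n (hHmeets n (not_lt.mp hlt)) hx hn
    · rintro ⟨k, hk, hxk⟩
      have hH : ∀ y ∈ H, y ∉ Z k := by
        intro y hy hyk
        have h1 := hHsub hy
        simp only [mem_iUnion, mem_setOf_eq, exists_prop] at h1
        obtain ⟨j, hj, hyj⟩ := h1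
        have := key y j k hyj hyk
        subst this
        omega
      refine ⟨fun hx => hH x hx hxk, ?_⟩
      intro n hn _ hxn
      have := key x n k hxn hxk
      subst this
      obtain ⟨y, hy, hyn⟩ := hn
      exact hH y hy hyn
  rw [hset]
  exact measure_biUnion_finset (fun i _ j _ hij => hdisj hij) (fun k _ => hZm k)
end
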